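/- Assume μ > r(c−l). For every integer n ≥ 0 and every d ≥ 0, B_{n+1}(d) ≤ B_n(d) (the expected utility is nonincreasing in the number of customers present); and for every n ≥ 0 and all 0 ≤ d ≤ d′, B_n(d′) ≤ B_n(d) (the expected utility is nonincreasing in the quoted lead-time). -/

import Mathlib

open MeasureTheory

/-- Density of the Gamma(n+1, μ) distribution: f_{n,μ}(x) = μ^{n+1} x^n e^{-μx} / n!. -/
noncomputable def gpdf (n : ℕ) (μ x : ℝ) : ℝ :=
  μ ^ (n + 1) * x ^ n * Real.exp (-(μ * x)) / (n.factorial : ℝ)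

/-- Expected CARA utility of a customer quoted lead-time `d` who joins when `n`
customers are present. -/
noncomputable def Bn (R p c l r μ : ℝ) (n : ℕ) (d : ℝ) : ℝ :=
  (∫ x in (0:ℝ)..d, (1 - Real.exp (-(r * (R - p - c * x)))) / r * gpdf n μ x)
  + ∫ x in Set.Ioi d,
      (1 - Real.exp (-(r * (R - p - l * d - (c - l) * x)))) / r * gpdf n μ x

/-- CARA utility of a customer with net reward `v` and quoted lead-time `d` who waits `x`. -/
noncomputable def caraUtility (v c l r d x : ℝ) : ℝ :=
  (1 - Real.exp (-(r * (v - (l * min x d + (c - l) * x))))) / r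

lemma integrableOn_pow_mul_exp_neg_mul (n : ℕ) {b : ℝ} (hb : 0 < b) :
    IntegrableOn (fun x : ℝ => x ^ n * Real.exp (-(b * x))) (Set.Ioi 0) := by
  have h := integrableOn_rpow_mul_exp_neg_mul_rpow (p := 1) (s := n) (b := b)
    (by have := n.cast_nonneg (α := ℝ); linarith) one_pos hb
  simpa [Real.rpow_natCast, Real.rpow_one, neg_mul] using h

lemma gpdf_eq_const_mul (n : ℕ) (μ x : ℝ) :
    gpdf n μ x = μ ^ (n + 1) / (n.factorial : ℝ) * (x ^ n * Real.exp (-(μ * x))) := by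
  unfold gpdf; ring

lemma gpdf_nonneg (n : ℕ) {μ x : ℝ} (hμ : 0 < μ) (hx : 0 ≤ x) : 0 ≤ gpdf n μ x := by
  unfold gpdf; positivity

lemma continuous_gpdf (n : ℕ) (μ : ℝ) : Continuous (gpdf n μ) := by
  unfold gpdf; fun_prop

lemma gpdf_succ (n : ℕ) (μ x : ℝ) :
    gpdf (n + 1) μ x = gpdf n μ x * (μ * x / (n + 1)) := by
  have h : (n + 1 : ℝ) ≠ 0 := by positivity
  have h' : (n.factorial : ℝ) ≠ 0 := by positivity
  unfold gpdf
  rw [Nat.factorial_succ]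
  push_cast
  field_simp
  ring

lemma integrableOn_gpdf (n : ℕ) {μ : ℝ} (hμ : 0 < μ) :
    IntegrableOn (gpdf n μ) (Set.Ioi 0) := by
  rw [funext (gpdf_eq_const_mul n μ)]
  exact (integrableOn_pow_mul_exp_neg_mul n hμ).const_mul _

lemma integral_gpdf (n : ℕ) {μ : ℝ} (hμ : 0 < μ) :
    ∫ x in Set.Ioi 0, gpdf n μ x = 1 := by
  have h := Real.integral_rpow_mul_exp_neg_mul_Ioi (a := n + 1) (r := μ) (by positivity) hμ
  have hn : (n.factorial : ℝ) ≠ 0 := by positivity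
  have hpow : (1 / μ) ^ ((n : ℝ) + 1) = (1 / μ) ^ (n + 1) := by
    rw [← Real.rpow_natCast]; push_cast; rfl
  simp only [add_sub_cancel_right, Real.rpow_natCast, Real.Gamma_nat_eq_factorial, hpow] at h
  simp_rw [gpdf_eq_const_mul]
  rw [integral_const_mul, h]
  field_simp
  rw [← mul_pow, mul_one_div_cancel hμ.ne', one_pow]

lemma continuous_caraUtility (v c l r d : ℝ) : Continuous (caraUtility v c l r d) := by
  unfold caraUtility; fun_prop

lemma caraUtility_le_of_cost_le {v c l r d d' x y : ℝ} (hr : 0 < r)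
    (h : l * min x d + (c - l) * x ≤ l * min y d' + (c - l) * y) :
    caraUtility v c l r d' y ≤ caraUtility v c l r d x := by
  unfold caraUtility
  gcongr

lemma caraUtility_antitone {v c l r d : ℝ} (hl0 : 0 ≤ l) (hlc : l ≤ c) (hr : 0 < r) :
    Antitone (caraUtility v c l r d) := by
  intro x y hxy
  have := sub_nonneg.2 hlc
  apply caraUtility_le_of_cost_le hr
  gcongr

lemma caraUtility_antitone_leadTime {v c l r d d' x : ℝ} (hl0 : 0 ≤ l) (hr : 0 < r)
    (hd : d ≤ d') : caraUtility v c l r d' x ≤ caraUtility v c l r d x := by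
  apply caraUtility_le_of_cost_le hr
  gcongr

lemma integrableOn_caraUtility_mul_gpdf {v c l r μ : ℝ} (hl0 : 0 ≤ l) (hr : 0 < r) (hμ0 : 0 < μ)
    (hμ : r * (c - l) < μ) (n : ℕ) (d : ℝ) :
    IntegrableOn (fun x => caraUtility v c l r d x * gpdf n μ x) (Set.Ioi 0) := by
  have hbound := ((integrableOn_gpdf n hμ0).add
    (((integrableOn_pow_mul_exp_neg_mul n (sub_pos.2 hμ)).const_mul
      (Real.exp (-(r * v) + r * (l * d)) * (μ ^ (n + 1) / (n.factorial : ℝ)))))).const_mul r⁻¹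
  refine hbound.mono'
    ((continuous_caraUtility v c l r d).mul (continuous_gpdf n μ)).aestronglyMeasurable ?_
  filter_upwards [ae_restrict_mem measurableSet_Ioi] with x hx
  have hg := gpdf_nonneg n hμ0 (le_of_lt hx)
  set E := Real.exp (-(r * (v - (l * min x d + (c - l) * x))))
  have hE : E ≤ Real.exp (-(r * v) + r * (l * d)) * Real.exp (r * (c - l) * x) := by
    rw [← Real.exp_add]
    apply Real.exp_le_exp.2
    have : r * (l * min x d) ≤ r * (l * d) := by
      gcongr
      exact min_le_right _ _
    linarith
  have hu : |caraUtility v c l r d x| ≤ r⁻¹ * (1 + E) := by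
    unfold caraUtility
    rw [abs_div, abs_of_pos hr, div_eq_inv_mul]
    gcongr
    have : 0 < E := Real.exp_pos _
    rw [abs_le]
    constructor <;> linarith
  have hsplit : Real.exp (-((μ - r * (c - l)) * x))
      = Real.exp (r * (c - l) * x) * Real.exp (-(μ * x)) := by
    rw [← Real.exp_add]; congr 1; ring
  rw [Real.norm_eq_abs, abs_mul, abs_of_nonneg hg]
  calc |caraUtility v c l r d x| * gpdf n μ x
      ≤ r⁻¹ * (1 + Real.exp (-(r * v) + r * (l * d)) * Real.exp (r * (c - l) * x))
          * gpdf n μ x := by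
        refine mul_le_mul_of_nonneg_right (hu.trans ?_) hg
        gcongr
    _ = _ := by
        simp only [Pi.add_apply, hsplit, gpdf_eq_const_mul]
        ring

lemma Bn_eq_integral_caraUtility {R p c l r μ : ℝ} (hl0 : 0 ≤ l) (hr : 0 < r) (hμ0 : 0 < μ)
    (hμ : r * (c - l) < μ) (n : ℕ) {d : ℝ} (hd : 0 ≤ d) :
    Bn R p c l r μ n d = ∫ x in Set.Ioi 0, caraUtility (R - p) c l r d x * gpdf n μ x := by
  have hint := integrableOn_caraUtility_mul_gpdf (v := R - p) hl0 hr hμ0 hμ n d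
  rw [← intervalIntegral.integral_interval_add_Ioi hint
    (hint.mono_set (Set.Ioi_subset_Ioi hd)), Bn]
  congr 1
  · refine intervalIntegral.integral_congr fun x hx => ?_
    rw [Set.uIcc_of_le hd] at hx
    simp only [caraUtility, min_eq_left hx.2]
    ring_nf
  · refine setIntegral_congr_fun measurableSet_Ioi fun x hx => ?_
    simp only [caraUtility, min_eq_right (le_of_lt (Set.mem_Ioi.1 hx))]
    ring_nf

/-- An antitone function has a smaller mean under `gpdf (n + 1) μ` than under `gpdf n μ`, because
the ratio of the two densities is increasing. -/
lemma integral_mul_gpdf_succ_le {u : ℝ → ℝ} (hu : Antitone u) (n : ℕ) {μ : ℝ} (hμ : 0 < μ)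
    (hint : IntegrableOn (fun x => u x * gpdf n μ x) (Set.Ioi 0))
    (hint' : IntegrableOn (fun x => u x * gpdf (n + 1) μ x) (Set.Ioi 0)) :
    ∫ x in Set.Ioi 0, u x * gpdf (n + 1) μ x ≤ ∫ x in Set.Ioi 0, u x * gpdf n μ x := by
  set a : ℝ := (n + 1) / μ with ha
  have hi := (integrableOn_gpdf n hμ).const_mul (u a)
  have hi' := (integrableOn_gpdf (n + 1) hμ).const_mul (u a)
  have key : ∫ x in Set.Ioi 0, (u x * gpdf (n + 1) μ x - u a * gpdf (n + 1) μ x)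
      ≤ ∫ x in Set.Ioi 0, (u x * gpdf n μ x - u a * gpdf n μ x) := by
    refine setIntegral_mono_on (hint'.sub hi') (hint.sub hi) measurableSet_Ioi fun x hx => ?_
    have hg := gpdf_nonneg n hμ (le_of_lt hx)
    have hn : (0 : ℝ) < n + 1 := by positivity
    suffices 0 ≤ (u x - u a) * (1 - μ * x / (n + 1)) by
      rw [gpdf_succ]
      nlinarith [mul_nonneg this hg]
    rcases le_total x a with hxa | hxa
    · refine mul_nonneg (sub_nonneg.2 (hu hxa)) (sub_nonneg.2 ?_)
      rw [ha, le_div_iff₀ hμ] at hxa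
      rw [div_le_one hn]
      linarith
    · refine mul_nonneg_of_nonpos_of_nonpos (sub_nonpos.2 (hu hxa)) (sub_nonpos.2 ?_)
      rw [ha, div_le_iff₀ hμ] at hxa
      rw [one_le_div hn]
      linarith
  rw [integral_sub hint' hi', integral_sub hint hi, integral_const_mul, integral_const_mul,
    integral_gpdf _ hμ, integral_gpdf _ hμ] at key
  linarith

/-- The expected utility is nonincreasing in the queue length and in the quoted lead-time. -/
theorem utility_monotone
    (R p c l r μ : ℝ) (hpR : p ≤ R) (hc : 0 < c) (hl0 : 0 ≤ l) (hlc : l ≤ c)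
    (hr : 0 < r) (hμ0 : 0 < μ) (hμ : r * (c - l) < μ) :
    (∀ (n : ℕ) (d : ℝ), 0 ≤ d → Bn R p c l r μ (n + 1) d ≤ Bn R p c l r μ n d) ∧
    (∀ (n : ℕ) (d d' : ℝ), 0 ≤ d → d ≤ d' → Bn R p c l r μ n d' ≤ Bn R p c l r μ n d) := by
  constructor
  · intro n d hd
    rw [Bn_eq_integral_caraUtility hl0 hr hμ0 hμ _ hd,
      Bn_eq_integral_caraUtility hl0 hr hμ0 hμ _ hd]
    exact integral_mul_gpdf_succ_le (caraUtility_antitone hl0 hlc hr) n hμ0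
      (integrableOn_caraUtility_mul_gpdf hl0 hr hμ0 hμ n d)
      (integrableOn_caraUtility_mul_gpdf hl0 hr hμ0 hμ (n + 1) d)
  · intro n d d' hd hdd'
    rw [Bn_eq_integral_caraUtility hl0 hr hμ0 hμ _ hd,
      Bn_eq_integral_caraUtility hl0 hr hμ0 hμ _ (hd.trans hdd')]
    exact setIntegral_mono_on (integrableOn_caraUtility_mul_gpdf hl0 hr hμ0 hμ n d')
      (integrableOn_caraUtility_mul_gpdf hl0 hr hμ0 hμ n d) measurableSet_Ioi fun x hx =>
        mul_le_mul_of_nonneg_right (caraUtility_antitone_leadTime hl0 hr hdd')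
          (gpdf_nonneg n hμ0 (le_of_lt hx))
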